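/- Let r ∈ (0, 5/3) and consider the path P₄ with symmetric edge weights c₁ = c₃ = 1/r and c₂ = 2/(5−3r) (so that 3/c₁ + 4/c₂ + 3/c₃ = 10). Then the algebraic connectivity is given by λ₂ = (5 − r − √(13r² − 30r + 25)) / (r(5 − 3r)). -/

import Mathlib

open Matrix

/-- The Laplacian of the weighted path `P₄` with edge weights `c₁, c₂, c₃`. -/
noncomputable def lapP4 (c₁ c₂ c₃ : ℝ) : Matrix (Fin 4) (Fin 4) ℝ :=
  !![c₁, -c₁, 0, 0; -c₁, c₁ + c₂, -c₂, 0; 0, -c₂, c₂ + c₃, -c₃; 0, 0, -c₃, c₃]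

/-- The algebraic connectivity `λ₂` of the weighted path `P₄`: the minimum (here: infimum,
which is attained) of the Rayleigh quotient `⟨Lx, x⟩ / ⟨x, x⟩` over nonzero `x ∈ ℝ⁴` with
`x₁ + x₂ + x₃ + x₄ = 0`; equivalently, the second smallest eigenvalue of the Laplacian. -/
noncomputable def lambda2P4 (c₁ c₂ c₃ : ℝ) : ℝ :=
  sInf {R : ℝ | ∃ x : Fin 4 → ℝ, x ≠ 0 ∧ x 0 + x 1 + x 2 + x 3 = 0 ∧
    R = ((lapP4 c₁ c₂ c₃).mulVec x ⬝ᵥ x) / (x ⬝ᵥ x)}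

theorem lapP4_mulVec_dotProduct (c₁ c₂ c₃ : ℝ) (x : Fin 4 → ℝ) :
    (lapP4 c₁ c₂ c₃).mulVec x ⬝ᵥ x =
      c₁ * (x 0 - x 1) ^ 2 + c₂ * (x 1 - x 2) ^ 2 + c₃ * (x 2 - x 3) ^ 2 := by
  simp [lapP4, mulVec, dotProduct, Fin.sum_univ_four]
  ring

/-- Lower bound for the symmetric Laplacian form. The number `a - p` is the smaller eigenvalue on
antisymmetric vectors as soon as `p * (p + 2 * b) = a ^ 2` with `p > 0`. -/
theorem mul_dotProduct_self_le_lapP4 {a b p : ℝ} (ha : 0 < a) (hp : 0 < p)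
    (hpab : p * (p + 2 * b) = a ^ 2) {x : Fin 4 → ℝ} (hx : x 0 + x 1 + x 2 + x 3 = 0) :
    (a - p) * (x ⬝ᵥ x) ≤ (lapP4 a b a).mulVec x ⬝ᵥ x := by
  rw [lapP4_mulVec_dotProduct]
  simp only [dotProduct, Fin.sum_univ_four]
  have h3 : x 3 = -(x 0 + x 1 + x 2) := by linarith
  have hsq : 0 ≤ (p * (x 0 - x 3) - a * (x 1 - x 2)) ^ 2 / (2 * p) +
      (a + p) * (x 0 + x 3) ^ 2 := by positivity
  have hexp : (p * (x 0 - x 3) - a * (x 1 - x 2)) ^ 2 / (2 * p) =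
      (p * (x 0 - x 3) ^ 2 - 2 * a * (x 0 - x 3) * (x 1 - x 2) +
        (p + 2 * b) * (x 1 - x 2) ^ 2) / 2 := by
    field_simp
    linear_combination -(x 1 - x 2) ^ 2 * hpab
  rw [hexp] at hsq
  rw [h3] at hsq ⊢
  linarith

/-- The algebraic connectivity of `P₄` with symmetric positive edge weights. -/
theorem lambda2P4_symmetric {a b : ℝ} (ha : 0 < a) (hb : 0 < b) :
    lambda2P4 a b a = a + b - Real.sqrt (a ^ 2 + b ^ 2) := by
  obtain ⟨p, hp⟩ : ∃ p, p = Real.sqrt (a ^ 2 + b ^ 2) - b := ⟨_, rfl⟩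
  have hp_pos : 0 < p := by
    rw [hp, sub_pos]
    exact Real.lt_sqrt_of_sq_lt (by nlinarith)
  have hpab : p * (p + 2 * b) = a ^ 2 := by
    have := Real.sq_sqrt (show 0 ≤ a ^ 2 + b ^ 2 by positivity)
    rw [hp]
    linear_combination this
  rw [show a + b - Real.sqrt (a ^ 2 + b ^ 2) = a - p by rw [hp]; ring]
  refine IsLeast.csInf_eq ⟨⟨![a, p, -p, -a], ?_, ?_, ?_⟩, ?_⟩
  · exact fun h => ha.ne' (congrFun h 0)
  · simp
  · rw [lapP4_mulVec_dotProduct, eq_div_iff]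
    · simp [dotProduct, Fin.sum_univ_four]
      linear_combination (-2 * p) * hpab
    · simp [dotProduct, Fin.sum_univ_four]
      positivity
  · rintro R ⟨x, hx, hsum, rfl⟩
    have hxx : 0 < x ⬝ᵥ x :=
      (Finset.sum_nonneg fun i _ => mul_self_nonneg (x i)).lt_of_ne'
        (dotProduct_self_eq_zero.not.mpr hx)
    exact (le_div_iff₀ hxx).mpr (mul_dotProduct_self_le_lapP4 ha hp_pos hpab hsum)

/-- **The algebraic connectivity of symmetrically weighted `P₄` with total effective
resistance `10`.**  For `r ∈ (0, 5/3)` and edge weights `c₁ = c₃ = 1/r`,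
`c₂ = 2/(5 - 3r)` on the path `P₄` (so that `3/c₁ + 4/c₂ + 3/c₃ = 10`), the algebraic
connectivity is `λ₂ = (5 - r - √(13r² - 30r + 25)) / (r(5 - 3r))`. -/
theorem lambda2P4_symmetric_formula
    (r : ℝ) (hr : r ∈ Set.Ioo (0 : ℝ) (5 / 3)) :
    lambda2P4 (1 / r) (2 / (5 - 3 * r)) (1 / r) =
      (5 - r - Real.sqrt (13 * r ^ 2 - 30 * r + 25)) / (r * (5 - 3 * r)) := by
  obtain ⟨hr0, hr1⟩ := hr
  obtain ⟨s, hsr⟩ : ∃ s, s = 5 - 3 * r := ⟨_, rfl⟩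
  have hs : 0 < s := by linarith
  rw [← hsr]
  have hsqrt : Real.sqrt ((1 / r) ^ 2 + (2 / s) ^ 2) =
      Real.sqrt (13 * r ^ 2 - 30 * r + 25) / (r * s) := by
    rw [show 13 * r ^ 2 - 30 * r + 25 = s ^ 2 + 4 * r ^ 2 by rw [hsr]; ring,
      show (1 / r) ^ 2 + (2 / s) ^ 2 = (s ^ 2 + 4 * r ^ 2) / (r * s) ^ 2 by field_simp; ring,
      Real.sqrt_div' _ (sq_nonneg _), Real.sqrt_sq (by positivity)]
  rw [lambda2P4_symmetric (by positivity) (by positivity), hsqrt]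
  field_simp
  linear_combination hsr
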